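/- Let $S$ be an $F$-finite regular local ring of prime characteristic $p$, $I \subseteq S$ an ideal, $R = S/I$, and $\mathfrak{a} \subseteq S$ an ideal. Then Fedder's isomorphism $\Psi : (I^{[p^e]}:I)/I^{[p^e]} \to \mathrm{Hom}_R({}^e R, R)$ restricts to an isomorphism $(\mathfrak{a}(I^{[p^e]}:I) + I^{[p^e]})/I^{[p^e]} \cong \overline{\mathfrak{a}} \cdot \mathrm{Hom}_R({}^e R, R)$, where $\overline{\mathfrak{a}} = \mathfrak{a}R$ and $R$ acts on $\mathrm{Hom}_R({}^e R, R)$ by premultiplication. -/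

import Mathlib

/-- A Noetherian local ring is regular if its maximal ideal is generated by
`dim R` elements. -/
def IsRegularLocal (S : Type*) [CommRing S] [IsLocalRing S] : Prop :=
  IsNoetherianRing S ∧ ∃ (n : ℕ) (y : Fin n → S),
    Ideal.span (Set.range y) = IsLocalRing.maximalIdeal S ∧ ringKrullDim S = n

open RingTheory.Sequence Pointwise in
theorem RingTheory.Sequence.IsWeaklyRegular.of_shortExact {R : Type*} [CommRing R]
    {M₁ M₂ M₃ : Type*} [AddCommGroup M₁] [Module R M₁] [AddCommGroup M₂] [Module R M₂]
    [AddCommGroup M₃] [Module R M₃] {rs : List R} {f : M₁ →ₗ[R] M₂} {g : M₂ →ₗ[R] M₃}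
    (hf : Function.Injective f) (hfg : Function.Exact f g) (hg : Function.Surjective g)
    (h₁ : IsWeaklyRegular M₁ rs) (h₃ : IsWeaklyRegular M₃ rs) : IsWeaklyRegular M₂ rs := by
  induction rs generalizing M₁ M₂ M₃ with
  | nil => exact .nil R _
  | cons r rs ih =>
    rw [isWeaklyRegular_cons_iff] at h₁ h₃
    refine .cons (isSMulRegular_of_range_eq_ker hf hfg.linearMap_ker_eq.symm h₁.1 h₃.1) ?_
    refine ih (f := QuotSMulTop.map r f) (g := QuotSMulTop.map r g) ?_
      (QuotSMulTop.map_exact r hfg hg) (QuotSMulTop.map_surjective r hg) h₁.2 h₃.2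
    have h0 : Function.Exact (0 : M₁ →ₗ[R] M₁) f := fun x ↦ by
      simp [map_eq_zero_iff f hf, eq_comm]
    have h := QuotSMulTop.map_first_exact_on_four_term_exact_of_isSMulRegular_last h0 hfg h₃.1
    rw [injective_iff_map_eq_zero]
    intro x hx
    obtain ⟨y, rfl⟩ := (h x).1 hx
    simp

open RingTheory.Sequence Pointwise in
theorem RingTheory.Sequence.IsWeaklyRegular.quotSMulTop_pow {R : Type*} [CommRing R]
    {M : Type*} [AddCommGroup M] [Module R M] {r : R} {rs : List R} (hr : IsSMulRegular M r)
    (h : IsWeaklyRegular (QuotSMulTop r M) rs) (k : ℕ) :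
    IsWeaklyRegular (QuotSMulTop (r ^ k) M) rs := by
  induction k with
  | zero =>
    have : Subsingleton (QuotSMulTop (r ^ 0) M) := by
      rw [Submodule.Quotient.subsingleton_iff]
      simp
    refine ⟨fun i _ ↦ ?_⟩
    have := (Submodule.mkQ_surjective
      (Ideal.ofList (rs.take i) • ⊤ : Submodule R (QuotSMulTop (r ^ 0) M))).subsingleton
    exact Function.injective_of_subsingleton _
  | succ k ih =>
    let f : QuotSMulTop r M →ₗ[R] QuotSMulTop (r ^ (k + 1)) M :=
      Submodule.mapQ _ _ (LinearMap.lsmul R M (r ^ k)) (by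
        intro x hx
        obtain ⟨y, -, rfl⟩ := (Submodule.mem_smul_pointwise_iff_exists _ _ _).1 hx
        simpa [smul_smul, pow_succ'] using
          Submodule.smul_mem_pointwise_smul y (r ^ (k + 1)) (⊤ : Submodule R M) trivial)
    let g : QuotSMulTop (r ^ (k + 1)) M →ₗ[R] QuotSMulTop (r ^ k) M :=
      Submodule.factor (by
        intro x hx
        obtain ⟨y, -, rfl⟩ := (Submodule.mem_smul_pointwise_iff_exists _ _ _).1 hx
        simpa [smul_smul, pow_succ] using
          Submodule.smul_mem_pointwise_smul (r • y) (r ^ k) ⊤ trivial)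
    refine of_shortExact (f := f) (g := g) ?_ ?_ ?_ h ih
    · rw [injective_iff_map_eq_zero]
      intro x hx
      obtain ⟨x, rfl⟩ := Submodule.mkQ_surjective _ x
      obtain ⟨y, -, hy⟩ := (Submodule.mem_smul_pointwise_iff_exists _ _ _).1
        ((Submodule.Quotient.mk_eq_zero _).1 hx)
      have : x = r • y := by
        apply hr.pow k
        simpa [smul_smul, ← pow_succ] using hy.symm
      exact (Submodule.Quotient.mk_eq_zero _).2
        (this ▸ Submodule.smul_mem_pointwise_smul y _ ⊤ trivial)
    · intro x
      obtain ⟨x, rfl⟩ := Submodule.mkQ_surjective _ x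
      constructor
      · intro hx
        obtain ⟨y, -, rfl⟩ := (Submodule.mem_smul_pointwise_iff_exists _ _ _).1
          ((Submodule.Quotient.mk_eq_zero _).1 hx)
        exact ⟨Submodule.Quotient.mk y, rfl⟩
      · rintro ⟨y, hy⟩
        obtain ⟨y, rfl⟩ := Submodule.mkQ_surjective _ y
        rw [← hy]
        exact (Submodule.Quotient.mk_eq_zero _).2 (Submodule.smul_mem_pointwise_smul y _ ⊤ trivial)
    · exact Submodule.factor_surjective _

open RingTheory.Sequence Pointwise in
theorem RingTheory.Sequence.IsWeaklyRegular.map_pow {R : Type*} [CommRing R]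
    {M : Type*} [AddCommGroup M] [Module R M] {rs : List R} (h : IsWeaklyRegular M rs) (k : ℕ) :
    IsWeaklyRegular M (rs.map (· ^ k)) := by
  induction rs generalizing M with
  | nil => exact .nil R _
  | cons r rs ih =>
    rw [isWeaklyRegular_cons_iff] at h
    exact .cons (h.1.pow k) (ih (h.2.quotSMulTop_pow h.1 k))


theorem IsLocalRing.of_quotient_span_singleton {R : Type*} [CommRing R] [IsLocalRing R] {r : R}
    (hr : r ∈ IsLocalRing.maximalIdeal R) : IsLocalRing (R ⧸ Ideal.span {r}) :=
  have : Nontrivial (R ⧸ Ideal.span {r}) := Ideal.Quotient.nontrivial_iff.2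
    (ne_top_of_le_ne_top (Ideal.IsPrime.ne_top') ((Ideal.span_singleton_le_iff_mem _).2 hr))
  .of_surjective' _ Ideal.Quotient.mk_surjective

open RingTheory.Sequence IsLocalRing in
theorem IsLocalRing.ofList_map_quotient_eq_maximalIdeal {R : Type*} [CommRing R] [IsLocalRing R]
    {r : R} {rs : List R} (h : Ideal.ofList (r :: rs) = maximalIdeal R)
    [IsLocalRing (R ⧸ Ideal.span {r})] :
    Ideal.ofList (rs.map (Ideal.Quotient.mk (Ideal.span {r}))) =
      maximalIdeal (R ⧸ Ideal.span {r}) := by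
  rw [← map_maximalIdeal_of_surjective _ Ideal.Quotient.mk_surjective, ← h, Ideal.ofList_cons,
    Ideal.map_sup, Ideal.map_quotient_self, bot_sup_eq, Ideal.map_ofList]

open RingTheory.Sequence Pointwise in
theorem RingTheory.Sequence.isWeaklyRegular_self_cons_iff {R : Type*} [CommRing R] (r : R)
    (rs : List R) : IsWeaklyRegular R (r :: rs) ↔ IsSMulRegular R r ∧
      IsWeaklyRegular (R ⧸ Ideal.span {r}) (rs.map (Ideal.Quotient.mk (Ideal.span {r}))) := by
  rw [isWeaklyRegular_cons_iff, ← Ideal.Quotient.algebraMap_eq,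
    isWeaklyRegular_map_algebraMap_iff]
  refine and_congr_right' (LinearEquiv.isWeaklyRegular_congr
    (Submodule.quotEquivOfEq _ _ ?_) _)
  simp [← Submodule.ideal_span_singleton_smul]

open RingTheory.Sequence Pointwise IsLocalRing in
theorem Module.free_of_isWeaklyRegular {R : Type*} [CommRing R] [IsLocalRing R]
    [IsNoetherianRing R] {M : Type*} [AddCommGroup M] [Module R M] [Module.Finite R M]
    {rs : List R} (hrs : Ideal.ofList rs = maximalIdeal R) (hR : IsWeaklyRegular R rs)
    (hM : IsWeaklyRegular M rs) : Module.Free R M := by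
  induction hn : rs.length generalizing R M with
  | zero =>
    obtain rfl := List.length_eq_zero_iff.1 hn
    rw [Ideal.ofList_nil, eq_comm, ← isField_iff_maximalIdeal_eq] at hrs
    let := hrs.toField
    infer_instance
  | succ n ih =>
    obtain ⟨r, rs, rfl⟩ := List.exists_cons_of_length_eq_add_one hn
    have hr : r ∈ maximalIdeal R := hrs ▸ Ideal.subset_span List.mem_cons_self
    rw [isWeaklyRegular_self_cons_iff] at hR
    rw [isWeaklyRegular_cons_iff'] at hM
    have := IsLocalRing.of_quotient_span_singleton hr
    have := Module.finitePresentation_of_finite R M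
    have : Module.Finite (R ⧸ Ideal.span {r}) (QuotSMulTop r M) :=
      Module.Finite.of_restrictScalars_finite R _ _
    rw [← Module.free_quotSMulTop_iff_free R M
      (by simpa [IsLocalRing.jacobson_eq_maximalIdeal] using hr) hM.1]
    exact ih (ofList_map_quotient_eq_maximalIdeal hrs) hR.2 hM.2 (by simpa using hn)

open IsLocalRing in
theorem IsLocalRing.spanFinrank_quotient_lt {R : Type*} [CommRing R] [IsLocalRing R]
    [IsNoetherianRing R] {y : R} (hy : y ∈ maximalIdeal R) (hy2 : y ∉ maximalIdeal R ^ 2)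
    [IsLocalRing (R ⧸ Ideal.span {y})] :
    (maximalIdeal (R ⧸ Ideal.span {y})).spanFinrank < (maximalIdeal R).spanFinrank := by
  classical
  obtain ⟨s, hs, hspan⟩ :=
    (IsNoetherian.noetherian (maximalIdeal R)).exists_span_finset_card_eq_spanFinrank
  obtain ⟨f, -, hf⟩ := Submodule.mem_span_finset.1 (hspan ▸ hy)
  obtain ⟨i, hi, hfi⟩ : ∃ i ∈ s, f i ∉ maximalIdeal R := by
    by_contra! h
    refine hy2 (hf ▸ Ideal.sum_mem _ fun i hi ↦ ?_)
    rw [pow_two]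
    exact Ideal.mul_mem_mul (h i hi) (hspan ▸ Submodule.subset_span hi)
  have key : maximalIdeal (R ⧸ Ideal.span {y}) =
      Submodule.span _ (((s.erase i).image (Ideal.Quotient.mk (Ideal.span {y})) :
        Finset (R ⧸ Ideal.span {y})) : Set (R ⧸ Ideal.span {y})) := by
    rw [← map_maximalIdeal_of_surjective _ Ideal.Quotient.mk_surjective, ← hspan,
      Finset.coe_image, ← Ideal.span, ← Ideal.span, ← Ideal.map_span]
    refine le_antisymm ?_ (Ideal.map_mono (Ideal.span_mono (by simp)))
    rw [Ideal.map_le_iff_le_comap, Ideal.span_le]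
    intro j hj
    by_cases hji : j = i
    · subst hji
      have hu : IsUnit (f j) := by simpa using hfi
      rw [SetLike.mem_coe, ← Ideal.unit_mul_mem_iff_mem _ hu, Ideal.mem_comap]
      have h0 : Ideal.Quotient.mk (Ideal.span {y}) (f j * j) =
          - Ideal.Quotient.mk (Ideal.span {y}) (∑ k ∈ s.erase j, f k * k) := by
        rw [eq_neg_iff_add_eq_zero, ← map_add, Finset.add_sum_erase s (fun k ↦ f k * k) hi,
          Ideal.Quotient.eq_zero_iff_mem]
        simp only [smul_eq_mul] at hf
        exact hf ▸ Ideal.mem_span_singleton_self _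
      rw [h0]
      exact neg_mem (Ideal.mem_map_of_mem _ (Ideal.sum_mem _ fun k hk ↦
        Ideal.mul_mem_left _ _ (Ideal.subset_span hk)))
    · exact Ideal.mem_map_of_mem _ (Ideal.subset_span (by simp [hji]; exact hj))
  calc _ ≤ _ := key ▸ Submodule.spanFinrank_span_le_ncard_of_finite (Finset.finite_toSet _)
    _ ≤ (s.erase i).card := by rw [Set.ncard_coe_finset]; exact Finset.card_image_le
    _ < s.card := Finset.card_erase_lt_of_mem hi
    _ = _ := hs

open IsLocalRing in
theorem IsRegularLocalRing.isDomain (R : Type*) [CommRing R] [IsRegularLocalRing R] :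
    IsDomain R := by
  induction hn : (maximalIdeal R).spanFinrank using Nat.strong_induction_on generalizing R with
  | _ n ih =>
  have hdim := IsRegularLocalRing.spanFinrank_maximalIdeal (R := R)
  by_cases hmin : maximalIdeal R ∈ minimalPrimes R
  · have h0 : maximalIdeal R = ⊥ := by
      rw [← Submodule.spanFinrank_eq_zero_iff_eq_bot (IsNoetherian.noetherian _)]
      have := maximalIdeal_height_eq_ringKrullDim (R := R)
      rw [Ideal.height_eq_zero_iff.2 hmin, ← hdim] at this
      exact_mod_cast this.symm
    exact (isField_iff_maximalIdeal_eq.2 h0).isDomain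
  obtain ⟨y, hy, hy2, hymin⟩ : ∃ y ∈ maximalIdeal R, y ∉ maximalIdeal R ^ 2 ∧
      ∀ P ∈ minimalPrimes R, y ∉ P := by
    by_contra! h
    obtain ⟨J, hJ, hle⟩ := (Ideal.subset_union_prime_finite
      (s := insert (maximalIdeal R ^ 2) (minimalPrimes R)) (f := id)
      ((minimalPrimes.finite_of_isNoetherianRing R).insert _)
      (maximalIdeal R ^ 2) (maximalIdeal R ^ 2)
      (fun i hi hi' _ ↦ (Set.mem_of_mem_insert_of_ne hi hi').isPrime)
      (I := maximalIdeal R)).1 fun y hy ↦ by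
        by_cases hy2 : y ∈ maximalIdeal R ^ 2
        · simp [hy2]
        · obtain ⟨P, hP, hyP⟩ := h y hy hy2
          exact Set.mem_biUnion (Set.mem_insert_of_mem _ hP) hyP
    have hmP : ∃ P ∈ minimalPrimes R, maximalIdeal R ≤ P := by
      rcases hJ with rfl | hJ
      · have h0 : maximalIdeal R = ⊥ := Submodule.eq_bot_of_le_smul_of_le_jacobson_bot
          (maximalIdeal R) _ (IsNoetherian.noetherian _) (by simpa [pow_two] using hle)
          (maximalIdeal_le_jacobson _)
        obtain ⟨P, hP⟩ := Ideal.nonempty_minimalPrimes (bot_ne_top (α := Ideal R))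
        exact ⟨P, hP, h0 ▸ bot_le⟩
      · exact ⟨J, hJ, hle⟩
    obtain ⟨P, hP, hmP⟩ := hmP
    have := hP.isPrime
    exact hmin (((maximalIdeal.isMaximal R).eq_of_le this.ne_top hmP) ▸ hP)
  have := IsLocalRing.of_quotient_span_singleton hy
  have hlt := IsLocalRing.spanFinrank_quotient_lt hy hy2
  have hreg : IsRegularLocalRing (R ⧸ Ideal.span {y}) := by
    refine .of_spanFinrank_maximalIdeal_le _ ?_
    have h1 := ringKrullDim_le_ringKrullDim_quotient_add_card ({y} : Finset R)
      (by simpa [ringJacobson_eq_maximalIdeal R] using hy)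
    rw [← hdim, Finset.coe_singleton, Finset.card_singleton] at h1
    have h2 : ((maximalIdeal (R ⧸ Ideal.span {y})).spanFinrank : WithBot ℕ∞) + 1 ≤
        (maximalIdeal R).spanFinrank := by exact_mod_cast hlt
    exact ENat.WithBot.add_le_add_one_right_iff.1 (h2.trans h1)
  have := ih _ (hn ▸ hlt) (R ⧸ Ideal.span {y}) rfl
  have hprime : (Ideal.span {y}).IsPrime := (Ideal.Quotient.isDomain_iff_prime _).1 this
  obtain ⟨Q, hQ, hQy⟩ := Ideal.exists_minimalPrimes_le (bot_le (a := Ideal.span {y}))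
  have hQp := hQ.isPrime
  have hQ0 : Q = ⊥ := by
    refine Submodule.eq_bot_of_le_smul_of_le_jacobson_bot (maximalIdeal R) _
      (IsNoetherian.noetherian _) (fun q hq ↦ ?_) (maximalIdeal_le_jacobson _)
    obtain ⟨t, rfl⟩ := Ideal.mem_span_singleton'.1 (hQy hq)
    rw [mul_comm]
    exact Ideal.mul_mem_mul hy ((hQp.mem_or_mem hq).resolve_right (hymin Q hQ))
  have : (⊥ : Ideal R).IsPrime := hQ0 ▸ hQp
  exact IsDomain.of_bot_isPrime R

open RingTheory.Sequence IsLocalRing in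
theorem IsLocalRing.isWeaklyRegular_of_ringKrullDim_eq_length {R : Type*} [CommRing R]
    [IsLocalRing R] [IsNoetherianRing R] {rs : List R} (hrs : Ideal.ofList rs = maximalIdeal R)
    (hdim : ringKrullDim R = rs.length) : IsWeaklyRegular R rs := by
  induction hn : rs.length generalizing R with
  | zero =>
    obtain rfl := List.length_eq_zero_iff.1 hn
    exact .nil R R
  | succ n ih =>
    classical
    obtain ⟨r, rs, rfl⟩ := List.exists_cons_of_length_eq_add_one hn
    have hle (l : List R) : (Ideal.ofList l).spanFinrank ≤ l.length := by
      have h := Submodule.spanFinrank_span_le_ncard_of_finite (R := R) l.toFinset.finite_toSet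
      rw [Set.ncard_coe_finset] at h
      exact (by simpa [Ideal.ofList] using h : _ ≤ l.toFinset.card).trans l.toFinset_card_le
    have : IsRegularLocalRing R := .of_spanFinrank_maximalIdeal_le _ (by
      rw [hdim, ← hrs]; exact_mod_cast hle _)
    have := IsRegularLocalRing.isDomain R
    have hr : r ∈ maximalIdeal R := hrs ▸ Ideal.subset_span List.mem_cons_self
    have hr0 : r ≠ 0 := by
      rintro rfl
      have h := hle rs
      rw [Ideal.ofList_cons, Ideal.span_singleton_zero, bot_sup_eq] at hrs
      have h1 := IsRegularLocalRing.spanFinrank_maximalIdeal (R := R)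
      rw [hdim, ← hrs, Nat.cast_inj, List.length_cons] at h1
      omega
    have hreg : IsSMulRegular R r := IsSMulRegular.of_ne_zero hr0
    have := IsLocalRing.of_quotient_span_singleton hr
    refine (isWeaklyRegular_self_cons_iff r rs).2 ⟨hreg,
      ih (ofList_map_quotient_eq_maximalIdeal hrs) ?_ (by simpa using hn)⟩
    have h := ringKrullDim_quotient_span_singleton_succ_eq_ringKrullDim hreg hr
    rw [hdim, List.length_cons, Nat.cast_add] at h
    rw [List.length_map]
    exact le_antisymm (ENat.WithBot.add_le_add_one_right_iff.1 h.le)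
      (ENat.WithBot.add_le_add_one_right_iff.1 h.ge)

open RingTheory.Sequence IsLocalRing in
theorem RingHom.exists_dualBasis_of_isWeaklyRegular {S T : Type*} [CommRing S] [IsLocalRing S]
    [IsNoetherianRing S] [CommRing T] {f : S →+* T} (hf : f.Finite) {rs : List S}
    (hrs : Ideal.ofList rs = maximalIdeal S) (hS : IsWeaklyRegular S rs)
    (hT : IsWeaklyRegular T (rs.map f)) :
    ∃ (n : ℕ) (m : Fin n → T) (c : Fin n → T →+ S),
      (∀ i r x, c i (f r * x) = r * c i x) ∧ ∀ x, x = ∑ i, f (c i x) * m i := by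
  let := f.toAlgebra
  have : Module.Finite S T := hf
  have : Module.Free S T := Module.free_of_isWeaklyRegular hrs hS
    ((isWeaklyRegular_map_algebraMap_iff T T rs).1 hT)
  let b := Module.finBasis S T
  refine ⟨_, b, fun i ↦ (b.coord i).toAddMonoidHom, fun i r x ↦ ?_, fun x ↦ ?_⟩
  · exact (b.coord i).map_smul r x
  · exact (b.sum_repr x).symm

theorem iterateFrobenius_finite {S : Type*} [CommRing S] (p : ℕ) [ExpChar S p]
    (hF : (frobenius S p).Finite) (e : ℕ) : (iterateFrobenius S p e).Finite := by
  induction e with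
  | zero => exact iterateFrobenius_zero S p ▸ .id S
  | succ e ih =>
    rw [iterateFrobenius_add, iterateFrobenius_one]
    exact ih.comp hF

open RingTheory.Sequence in
theorem IsRegularLocal.exists_dualBasis_iterateFrobenius {S : Type*} [CommRing S] [IsLocalRing S]
    (hreg : IsRegularLocal S) (p : ℕ) [Fact p.Prime] [CharP S p] (hF : (frobenius S p).Finite)
    (e : ℕ) :
    ∃ (n : ℕ) (m : Fin n → S) (c : Fin n → S →+ S),
      (∀ i r x, c i (r ^ p ^ e * x) = r * c i x) ∧ ∀ x, x = ∑ i, c i x ^ p ^ e * m i := by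
  obtain ⟨hN, n, y, hy, hdim⟩ := hreg
  have hrs : Ideal.ofList (List.ofFn y) = IsLocalRing.maximalIdeal S := by
    have : {r | r ∈ List.ofFn y} = Set.range y := by ext; simp
    rw [← hy, Ideal.ofList, this]
  have hS := IsLocalRing.isWeaklyRegular_of_ringKrullDim_eq_length hrs (by simpa using hdim)
  exact RingHom.exists_dualBasis_of_isWeaklyRegular (f := iterateFrobenius S p e)
    (iterateFrobenius_finite p hF e) hrs hS (hS.map_pow (p ^ e))

theorem map_mul_mem_of_mem_span_pow {S : Type*} [CommRing S] {I : Ideal S} {q : ℕ} {Tr : S →+ S}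
    (hTr : ∀ r x : S, Tr (r ^ q * x) = r * Tr x) {s : S}
    (hs : s ∈ Ideal.span ((fun x => x ^ q) '' (I : Set S))) (x : S) : Tr (s * x) ∈ I := by
  induction hs using Submodule.span_induction generalizing x with
  | mem s h =>
    obtain ⟨r, hr, rfl⟩ := h
    rw [hTr]
    exact I.mul_mem_right _ hr
  | zero => simp
  | add s t _ _ hs ht => rw [add_mul, map_add]; exact add_mem (hs x) (ht x)
  | smul r s _ hs => rw [smul_eq_mul, mul_comm r, mul_assoc]; exact hs _

theorem mem_span_pow_of_map_mul_mem {S ι : Type*} [CommRing S] [Fintype ι] {I : Ideal S} {q : ℕ}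
    {Tr : S →+ S}
    (hTrGen : ∀ ψ : S →+ S, (∀ r x : S, ψ (r ^ q * x) = r * ψ x) →
      ∃ u : S, ∀ x : S, ψ x = Tr (u * x))
    {m : ι → S} {c : ι → S →+ S} (hc : ∀ i r x, c i (r ^ q * x) = r * c i x)
    (hm : ∀ x, x = ∑ i, c i x ^ q * m i) {s : S} (hs : ∀ x, Tr (s * x) ∈ I) :
    s ∈ Ideal.span ((fun x => x ^ q) '' (I : Set S)) := by
  rw [hm s]
  refine Ideal.sum_mem _ fun i _ ↦ Ideal.mul_mem_right _ _ (Ideal.subset_span ⟨_, ?_, rfl⟩)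
  obtain ⟨u, hu⟩ := hTrGen (c i) (hc i)
  rw [hu, mul_comm]
  exact hs u

theorem exists_mem_colon_forall_eq_mk_map_mul {S ι : Type*} [CommRing S] [Fintype ι]
    {I : Ideal S} {q : ℕ} {Tr : S →+ S}
    (hTrGen : ∀ ψ : S →+ S, (∀ r x : S, ψ (r ^ q * x) = r * ψ x) →
      ∃ u : S, ∀ x : S, ψ x = Tr (u * x))
    {m : ι → S} {c : ι → S →+ S} (hc : ∀ i r x, c i (r ^ q * x) = r * c i x)
    (hm : ∀ x, x = ∑ i, c i x ^ q * m i) {ψ : (S ⧸ I) →+ (S ⧸ I)}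
    (hψ : ∀ r x : S ⧸ I, ψ (r ^ q * x) = r * ψ x) :
    ∃ u ∈ Submodule.colon (Ideal.span ((fun x => x ^ q) '' (I : Set S))) (I : Set S),
      ∀ x : S, ψ (Ideal.Quotient.mk I x) = Ideal.Quotient.mk I (Tr (u * x)) := by
  choose d hd using fun i ↦ Ideal.Quotient.mk_surjective (ψ (Ideal.Quotient.mk I (m i)))
  obtain ⟨u, hu⟩ := hTrGen (∑ i, (AddMonoidHom.mulRight (d i)).comp (c i)) fun r x ↦ by
    simp [hc, Finset.mul_sum, mul_assoc]
  have key (x : S) : ψ (Ideal.Quotient.mk I x) = Ideal.Quotient.mk I (Tr (u * x)) := by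
    rw [← hu]
    conv_lhs => rw [hm x]
    simp [hd, hψ]
  refine ⟨u, Submodule.mem_colon.2 fun x hx ↦ mem_span_pow_of_map_mul_mem hTrGen hc hm fun y ↦ ?_,
    key⟩
  rw [smul_eq_mul, mul_assoc, ← Ideal.Quotient.eq_zero_iff_mem, ← key,
    Ideal.Quotient.eq_zero_iff_mem.2 (I.mul_mem_right y hx), map_zero]

theorem exists_addMonoidHom_quotient_of_mem_colon {S : Type*} [CommRing S] {I : Ideal S} {q : ℕ}
    {Tr : S →+ S} (hTr : ∀ r x : S, Tr (r ^ q * x) = r * Tr x) {u : S}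
    (hu : u ∈ Submodule.colon (Ideal.span ((fun x => x ^ q) '' (I : Set S))) (I : Set S)) :
    ∃ ψ : (S ⧸ I) →+ (S ⧸ I), (∀ r x : S ⧸ I, ψ (r ^ q * x) = r * ψ x) ∧
      ∀ x : S, ψ (Ideal.Quotient.mk I x) = Ideal.Quotient.mk I (Tr (u * x)) := by
  let g : S →+ S ⧸ I := (Ideal.Quotient.mk I).toAddMonoidHom.comp
    (Tr.comp (AddMonoidHom.mulLeft u))
  have hg (x : S) (hx : x ∈ I) : g x = 0 := by
    have := map_mul_mem_of_mem_span_pow hTr (Submodule.mem_colon.1 hu x hx) 1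
    simpa [g, Ideal.Quotient.eq_zero_iff_mem] using this
  let ψ : (S ⧸ I) →+ (S ⧸ I) := QuotientAddGroup.lift I.toAddSubgroup g hg
  have hψ (x : S) : ψ (Ideal.Quotient.mk I x) = Ideal.Quotient.mk I (Tr (u * x)) := rfl
  refine ⟨ψ, fun r x ↦ ?_, hψ⟩
  obtain ⟨r, rfl⟩ := Ideal.Quotient.mk_surjective r
  obtain ⟨x, rfl⟩ := Ideal.Quotient.mk_surjective x
  rw [← map_pow, ← map_mul, hψ, hψ, mul_left_comm, hTr, map_mul]

/-- In the setting of Fedder's isomorphism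
`Ψ : (I^{[pᵉ]}:I)/I^{[pᵉ]} ≅ Hom_R(ᵉR,R)` (`R = S/I`, `S` an `F`-finite regular local ring
of characteristic `p`, `Tr` a generator of `Hom_S(ᵉS,S)`), for any ideal `𝔞 ⊆ S` the map
`Ψ` restricts to an isomorphism `(𝔞(I^{[pᵉ]}:I) + I^{[pᵉ]})/I^{[pᵉ]} ≅ 𝔞R·Hom_R(ᵉR,R)`,
where `𝔞R·Hom_R(ᵉR,R)` is generated by the premultiplications `x ↦ ψ(a x)`, `a ∈ 𝔞R`. -/
theorem stmt12 {S : Type*} [CommRing S] [IsLocalRing S] (hreg : IsRegularLocal S)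
    (p : ℕ) [Fact p.Prime] [CharP S p] (hF : (frobenius S p).Finite)
    (I : Ideal S) (e : ℕ) (a : Ideal S)
    (Tr : S →+ S)
    (hTr : ∀ r x : S, Tr (r ^ p ^ e * x) = r * Tr x)
    (hTrGen : ∀ ψ : S →+ S, (∀ r x : S, ψ (r ^ p ^ e * x) = r * ψ x) →
      ∃ u : S, ∀ x : S, ψ x = Tr (u * x))
    -- `Fpow = I^{[pᵉ]}`, `C = (I^{[pᵉ]}:I)`, `aHom = 𝔞R ⋅ Hom_R(ᵉR,R)`
    (Fpow : Ideal S) (hFpow : Fpow = Ideal.span ((fun x => x ^ p ^ e) '' (I : Set S)))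
    (C : Ideal S) (hC : C = Submodule.colon Fpow I)
    (aHom : AddSubgroup ((S ⧸ I) →+ (S ⧸ I)))
    (haHom : aHom = AddSubgroup.closure
      {θ : (S ⧸ I) →+ (S ⧸ I) | ∃ b ∈ a.map (Ideal.Quotient.mk I),
        ∃ ψ : (S ⧸ I) →+ (S ⧸ I), (∀ r x : S ⧸ I, ψ (r ^ p ^ e * x) = r * ψ x) ∧
          ∀ x : S ⧸ I, θ x = ψ (b * x)}) :
    (∀ s ∈ a * C + Fpow,
      ∃ φ ∈ aHom,
        (∀ r x : S ⧸ I, φ (r ^ p ^ e * x) = r * φ x) ∧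
        ∀ x : S, φ (Ideal.Quotient.mk I x) = Ideal.Quotient.mk I (Tr (s * x))) ∧
    (∀ φ ∈ aHom,
      ∃ s ∈ a * C + Fpow,
        ∀ x : S, φ (Ideal.Quotient.mk I x) = Ideal.Quotient.mk I (Tr (s * x))) ∧
    (∀ s ∈ a * C + Fpow,
      ((∀ x : S, Ideal.Quotient.mk I (Tr (s * x)) = 0) ↔ s ∈ Fpow)) := by
  obtain ⟨n, m, c, hc, hm⟩ := hreg.exists_dualBasis_iterateFrobenius p hF e
  subst hFpow hC haHom
  refine ⟨fun s hs ↦ ?_, fun φ hφ ↦ ?_, fun s _ ↦ ?_⟩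
  · obtain ⟨t, ht, f, hf, rfl⟩ := Submodule.mem_sup.1 hs
    have hf0 (x : S) : Ideal.Quotient.mk I (Tr (f * x)) = 0 :=
      Ideal.Quotient.eq_zero_iff_mem.2 (map_mul_mem_of_mem_span_pow hTr hf x)
    simp only [add_mul, map_add, hf0, add_zero]
    clear hs
    induction ht using Submodule.mul_induction_on' with
    | mem_mul_mem b hb u hu =>
      obtain ⟨ψ, hψ, hψu⟩ := exists_addMonoidHom_quotient_of_mem_colon hTr hu
      refine ⟨ψ.comp (AddMonoidHom.mulLeft (Ideal.Quotient.mk I b)),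
        AddSubgroup.subset_closure ⟨_, Ideal.mem_map_of_mem _ hb, ψ, hψ, fun _ ↦ rfl⟩,
        fun r x ↦ ?_, fun x ↦ ?_⟩
      · simp [mul_left_comm, hψ]
      · rw [AddMonoidHom.comp_apply, AddMonoidHom.coe_mulLeft, ← map_mul, hψu, ← mul_assoc,
          mul_comm u]
    | add s _ t _ hs ht =>
      obtain ⟨φ, hφ, hφl, hφs⟩ := hs
      obtain ⟨θ, hθ, hθl, hθt⟩ := ht
      exact ⟨φ + θ, add_mem hφ hθ, fun r x ↦ by simp [hφl, hθl, mul_add],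
        fun x ↦ by simp [hφs, hθt, add_mul]⟩
  · induction hφ using AddSubgroup.closure_induction with
    | mem θ hθ =>
      obtain ⟨b, hb, ψ, hψ, hθ⟩ := hθ
      obtain ⟨b, hba, rfl⟩ :=
        (Ideal.mem_map_iff_of_surjective _ Ideal.Quotient.mk_surjective).1 hb
      obtain ⟨u, hu, hψu⟩ := exists_mem_colon_forall_eq_mk_map_mul hTrGen hc hm hψ
      refine ⟨b * u, Submodule.mem_sup_left (Ideal.mul_mem_mul hba hu), fun x ↦ ?_⟩
      rw [hθ, ← map_mul, hψu, ← mul_assoc, mul_comm u]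
    | zero => exact ⟨0, zero_mem _, by simp⟩
    | add φ θ _ _ hφ hθ =>
      obtain ⟨s, hs, hφ⟩ := hφ
      obtain ⟨t, ht, hθ⟩ := hθ
      exact ⟨s + t, add_mem hs ht, fun x ↦ by simp [hφ, hθ, add_mul]⟩
    | neg φ _ hφ =>
      obtain ⟨s, hs, hφ⟩ := hφ
      exact ⟨-s, neg_mem hs, fun x ↦ by simp [hφ]⟩
  · simp only [Ideal.Quotient.eq_zero_iff_mem]
    exact ⟨mem_span_pow_of_map_mul_mem hTrGen hc hm, map_mul_mem_of_mem_span_pow hTr⟩
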